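/- arXiv:1102.4744 — 2 statements merged into one kernel-verified Lean document; each statement's English description precedes it below -/
import Mathlib

section
/- Let A be real and B > 0 real with A/B not an integer, and let m ∈ ℤ be fixed with Ĵ_m ≠ 0. Then as n → ∞ (over the natural numbers), Υ(n, m, A, B)/(Ĵ_m·Γ(n + A/B)·B^{n + A/B}) tends to 1. -/
open Real

/-- Bessel function of the first kind of real order `ν`, for real `z > 0`,
defined by the series `∑ (−1)^m / (m! Γ(m+ν+1)) (z/2)^(2m+ν)` (real powers). -/
noncomputable def besselJ (ν z : ℝ) : ℝ :=
  ∑' m : ℕ, ((-1 : ℝ) ^ m / (m.factorial * Real.Gamma ((m : ℝ) + ν + 1)))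
      * (z / 2) ^ (2 * (m : ℝ) + ν)

/-- Bessel function of the second kind for non-integer real order. -/
noncomputable def besselY (ν z : ℝ) : ℝ :=
  (besselJ ν z * Real.cos (ν * Real.pi) - besselJ (-ν) z) / Real.sin (ν * Real.pi)

/-- `Ĵ_n = J_{n+A/B}(2/B)`. -/
noncomputable def Jhat (A B : ℝ) (n : ℤ) : ℝ := besselJ ((n : ℝ) + A / B) (2 / B)

/-- `Ŷ_n = Y_{n+A/B}(2/B)`. -/
noncomputable def Yhat (A B : ℝ) (n : ℤ) : ℝ := besselY ((n : ℝ) + A / B) (2 / B)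

/-- `Υ(n, m, A, B) = π (Ĵ_n Ŷ_m − Ĵ_m Ŷ_n)`. -/
noncomputable def Ups (n m : ℤ) (A B : ℝ) : ℝ :=
  Real.pi * (Jhat A B n * Yhat A B m - Jhat A B m * Yhat A B n)
lemma Gamma_add_nat_eq_prod (s : ℝ) (hs : ∀ k : ℤ, s ≠ k) (k : ℕ) :
    Real.Gamma (s + k) = Real.Gamma s * ∏ j ∈ Finset.range k, (s + j) := by
  induction k with
  | zero => simp
  | succ k ih =>
    have h : s + k ≠ 0 := fun h => hs (-k) (by push_cast; linarith)
    rw [Finset.prod_range_succ, ← mul_assoc, ← ih, Nat.cast_succ, ← add_assoc,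
      Real.Gamma_add_one h, mul_comm]

/-- The normalized series of `J_{-ν}`. -/
lemma besselJ_neg_div_eq (ν B : ℝ) (hB : 0 < B) (hν : ∀ k : ℤ, ν ≠ k) :
    Real.pi * besselJ (-ν) (2 / B) / (Real.sin (ν * Real.pi) * Real.Gamma ν * B ^ ν) =
      ∑' k : ℕ, (B⁻¹ ^ 2) ^ k / k.factorial * ∏ j ∈ Finset.range k, (ν - 1 - j)⁻¹ := by
  have hs : ∀ k : ℤ, 1 - ν ≠ k := fun k h => hν (1 - k) (by push_cast; linarith)
  have hG1 : Real.Gamma (1 - ν) ≠ 0 :=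
    Real.Gamma_ne_zero fun m h => hs (-m) (by push_cast; linarith)
  have hG : Real.Gamma ν ≠ 0 := Real.Gamma_ne_zero fun m h => hν (-m) (by push_cast; linarith)
  have hrefl := Real.Gamma_mul_Gamma_one_sub ν
  have hsin : Real.sin (Real.pi * ν) ≠ 0 := by
    intro h
    rw [h, div_zero] at hrefl
    exact mul_ne_zero hG hG1 hrefl
  have hc : Real.pi / (Real.sin (ν * Real.pi) * Real.Gamma ν * B ^ ν) =
      Real.Gamma (1 - ν) / B ^ ν := by
    have hBν := (Real.rpow_pos_of_pos hB ν).ne'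
    rw [mul_comm ν Real.pi]
    rw [eq_div_iff hsin] at hrefl
    field_simp
    linarith
  rw [mul_div_right_comm, hc, besselJ, ← tsum_mul_left]
  refine tsum_congr fun k => ?_
  have hpow : (2 / B / 2) ^ (2 * (k : ℝ) + -ν) = (B⁻¹ ^ 2) ^ k * B ^ ν := by
    have : 2 / B / 2 = B⁻¹ := by field_simp
    rw [this, Real.rpow_add (inv_pos.2 hB), Real.inv_rpow hB.le (-ν), Real.rpow_neg hB.le, inv_inv,
      ← pow_mul, ← Real.rpow_natCast]
    push_cast
    rfl
  have hprod : ∏ j ∈ Finset.range k, (1 - ν + (j : ℝ)) =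
      (-1) ^ k * ∏ j ∈ Finset.range k, (ν - 1 - j) := by
    rw [← Finset.card_range k, ← Finset.prod_const, Finset.card_range, ← Finset.prod_mul_distrib]
    exact Finset.prod_congr rfl fun j _ => by ring
  have hne : ∏ j ∈ Finset.range k, (ν - 1 - (j : ℝ)) ≠ 0 :=
    Finset.prod_ne_zero_iff.2 fun j _ h => hν (1 + j) (by push_cast; linarith)
  have hBν := (Real.rpow_pos_of_pos hB ν).ne'
  have hfac : (k.factorial : ℝ) ≠ 0 := by positivity
  rw [hpow, show (k : ℝ) + -ν + 1 = 1 - ν + k by ring, Gamma_add_nat_eq_prod _ hs, hprod,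
    Finset.prod_inv_distrib]
  field_simp

lemma tendsto_besselJ_neg_div (a B : ℝ) (hB : 0 < B) (ha : ∀ k : ℤ, a ≠ k) :
    Filter.Tendsto (fun n : ℕ => Real.pi * besselJ (-(n + a)) (2 / B) /
      (Real.sin ((n + a) * Real.pi) * Real.Gamma (n + a) * B ^ (n + a)))
      Filter.atTop (nhds 1) := by
  have hν : ∀ (n : ℕ) (k : ℤ), (n : ℝ) + a ≠ k := fun n k h =>
    ha (k - n) (by push_cast; linarith)
  simp_rw [fun n : ℕ => besselJ_neg_div_eq (n + a) B hB (hν n)]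
  have hδ : 0 < |a - round a| := abs_pos.2 (sub_ne_zero.2 (ha _))
  have hone : ∑' k : ℕ, (B⁻¹ ^ 2) ^ k / k.factorial * ∏ _j ∈ Finset.range k, (0 : ℝ) = 1 := by
    rw [tsum_eq_single 0 fun k hk => by simp [hk]]
    simp
  refine Filter.Tendsto.mono_right (tendsto_tsum_of_dominated_convergence
    (bound := fun k : ℕ => (B⁻¹ ^ 2 * |a - round a|⁻¹) ^ k / k.factorial)
    (g := fun k : ℕ => (B⁻¹ ^ 2) ^ k / k.factorial * ∏ _j ∈ Finset.range k, (0 : ℝ))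
    (Real.summable_pow_div_factorial _) (fun k => ?_)
    (Filter.Eventually.of_forall fun n k => ?_)) (by rw [hone])
  · refine Filter.Tendsto.const_mul _ (tendsto_finsetProd _ fun j _ => ?_)
    refine Filter.Tendsto.inv_tendsto_atTop ?_
    have := Filter.tendsto_atTop_add_const_right Filter.atTop (a - 1 - j)
      (tendsto_natCast_atTop_atTop (R := ℝ))
    exact this.congr fun n => by ring
  · rw [norm_mul, Real.norm_of_nonneg (by positivity), mul_pow, mul_div_right_comm, norm_prod]
    refine mul_le_mul_of_nonneg_left ?_ (by positivity)
    calc ∏ j ∈ Finset.range k, ‖((n : ℝ) + a - 1 - j)⁻¹‖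
        ≤ ∏ _j ∈ Finset.range k, |a - round a|⁻¹ := by
          refine Finset.prod_le_prod (fun _ _ => norm_nonneg _) fun j _ => ?_
          rw [norm_inv, Real.norm_eq_abs]
          refine inv_anti₀ hδ ((round_le a (1 + j - n)).trans_eq ?_)
          push_cast
          congr 1
          ring
      _ = |a - round a|⁻¹ ^ k := by simp

lemma abs_besselJ_le (ν B : ℝ) (hB : 0 < B) (hν : 1 ≤ ν) :
    |besselJ ν (2 / B)| ≤ (B ^ ν)⁻¹ * Real.exp (B⁻¹ ^ 2) := by
  have hsum : HasSum (fun k : ℕ => (B ^ ν)⁻¹ * ((B⁻¹ ^ 2) ^ k / k.factorial))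
      ((B ^ ν)⁻¹ * Real.exp (B⁻¹ ^ 2)) := by
    refine HasSum.mul_left _ ?_
    rw [Real.exp_eq_exp_ℝ]
    exact NormedSpace.expSeries_div_hasSum_exp (B⁻¹ ^ 2)
  rw [← Real.norm_eq_abs, besselJ]
  refine tsum_of_norm_bounded hsum fun k => ?_
  have hpow : (2 / B / 2) ^ (2 * (k : ℝ) + ν) = (B⁻¹ ^ 2) ^ k * (B ^ ν)⁻¹ := by
    have : 2 / B / 2 = B⁻¹ := by field_simp
    rw [this, Real.rpow_add (inv_pos.2 hB), Real.inv_rpow hB.le ν, ← pow_mul,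
      ← Real.rpow_natCast]
    push_cast
    rfl
  have hk : (0 : ℝ) ≤ k := k.cast_nonneg
  have hΓ : 1 ≤ Real.Gamma (k + ν + 1) := by
    have := Real.Gamma_strictMonoOn_Ici.monotoneOn (a := 2) (b := k + ν + 1)
      (by simp) (by simp only [Set.mem_Ici]; linarith) (by linarith)
    rwa [Real.Gamma_two] at this
  have hBν := Real.rpow_pos_of_pos hB ν
  rw [hpow, norm_mul, norm_div, norm_pow, norm_neg, norm_one, one_pow,
    Real.norm_of_nonneg (by positivity), Real.norm_of_nonneg (by positivity)]
  calc 1 / (k.factorial * Real.Gamma (k + ν + 1)) * ((B⁻¹ ^ 2) ^ k * (B ^ ν)⁻¹)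
      ≤ 1 / k.factorial * ((B⁻¹ ^ 2) ^ k * (B ^ ν)⁻¹) := by
        gcongr
        exact le_mul_of_one_le_right (by positivity) hΓ
    _ = _ := by ring

lemma tendsto_rpow_div_Gamma_atTop (a c : ℝ) (hc : 0 < c) :
    Filter.Tendsto (fun n : ℕ => c ^ (n + a) / Real.Gamma (n + a)) Filter.atTop (nhds 0) := by
  have hlin : Filter.Tendsto (fun n : ℕ => (n : ℝ) + a) Filter.atTop Filter.atTop :=
    Filter.tendsto_atTop_add_const_right _ a tendsto_natCast_atTop_atTop
  have hpos := hlin.eventually_gt_atTop 0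
  refine (summable_of_ratio_test_tendsto_lt_one (l := 0) one_pos ?_ ?_).tendsto_atTop_zero
  · filter_upwards [hpos] with n hn
    exact (div_pos (Real.rpow_pos_of_pos hc _) (Real.Gamma_pos_of_pos hn)).ne'
  · refine (hlin.const_div_atTop c).congr' ?_
    filter_upwards [hpos] with n hn
    have hΓ := Real.Gamma_pos_of_pos hn
    have hp := Real.rpow_pos_of_pos hc (n + a)
    rw [← norm_div, show ((n + 1 : ℕ) : ℝ) + a = n + a + 1 by push_cast; ring,
      Real.Gamma_add_one hn.ne', Real.rpow_add_one hc.ne', Real.norm_of_nonneg (by positivity)]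
    field_simp

lemma tendsto_besselJ_div (a B : ℝ) (hB : 0 < B) :
    Filter.Tendsto (fun n : ℕ => besselJ (n + a) (2 / B) / (Real.Gamma (n + a) * B ^ (n + a)))
      Filter.atTop (nhds 0) := by
  have hlin : Filter.Tendsto (fun n : ℕ => (n : ℝ) + a) Filter.atTop Filter.atTop :=
    Filter.tendsto_atTop_add_const_right _ a tendsto_natCast_atTop_atTop
  have hlim := (tendsto_rpow_div_Gamma_atTop a (B⁻¹ ^ 2) (by positivity)).mul_const
    (Real.exp (B⁻¹ ^ 2))
  rw [zero_mul] at hlim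
  refine squeeze_zero_norm' ?_ hlim
  filter_upwards [hlin.eventually_ge_atTop 1] with n hn
  have hΓ := Real.Gamma_pos_of_pos (one_pos.trans_le hn)
  have hp := Real.rpow_pos_of_pos hB (n + a)
  rw [norm_div, Real.norm_of_nonneg (mul_pos hΓ hp).le, Real.norm_eq_abs,
    div_le_iff₀ (mul_pos hΓ hp)]
  refine (abs_besselJ_le _ B hB hn).trans_eq ?_
  have hsq : (B⁻¹ ^ 2) ^ ((n : ℝ) + a) = (B ^ ((n : ℝ) + a))⁻¹ * (B ^ ((n : ℝ) + a))⁻¹ := by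
    rw [pow_two, Real.mul_rpow (by positivity) (by positivity), Real.inv_rpow hB.le]
  rw [hsq]
  field_simp

/-- For real `A` and `B > 0` with `A/B` not an integer, and `m ∈ ℤ` with
`Ĵ_m ≠ 0`, as `n → ∞` over the naturals,
`Υ(n, m, A, B) / (Ĵ_m Γ(n + A/B) B^(n + A/B)) → 1`. -/
theorem stmt_3 (A B : ℝ) (hB : 0 < B) (hAB : ∀ k : ℤ, A / B ≠ (k : ℝ))
    (m : ℤ) (hm : Jhat A B m ≠ 0) :
    Filter.Tendsto
      (fun n : ℕ =>
        Ups (n : ℤ) m A B /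
          (Jhat A B m * Real.Gamma ((n : ℝ) + A / B) * B ^ ((n : ℝ) + A / B)))
      Filter.atTop (nhds 1) := by
  set a := A / B with ha
  have hsin0 : Real.sin (a * Real.pi) ≠ 0 := fun h => by
    obtain ⟨k, hk⟩ := Real.sin_eq_zero_iff.1 h
    exact hAB k (mul_right_cancel₀ Real.pi_ne_zero hk.symm)
  have hJ := tendsto_besselJ_div a B hB
  have hN := tendsto_besselJ_neg_div a B hB hAB
  have hlim := (hJ.const_mul (Real.pi * Yhat A B m / Jhat A B m -
    Real.pi * (Real.cos (a * Real.pi) / Real.sin (a * Real.pi)))).add hN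
  rw [mul_zero, zero_add] at hlim
  refine hlim.congr fun n => ?_
  have hcos : Real.cos ((n + a) * Real.pi) = (-1) ^ n * Real.cos (a * Real.pi) := by
    rw [add_mul, add_comm, Real.cos_add_nat_mul_pi]
  have hsin : Real.sin ((n + a) * Real.pi) = (-1) ^ n * Real.sin (a * Real.pi) := by
    rw [add_mul, add_comm, Real.sin_add_nat_mul_pi]
  have hG : Real.Gamma (n + a) ≠ 0 := Real.Gamma_ne_zero fun k h =>
    hAB (-k - n) (by push_cast; linarith)
  have hp := (Real.rpow_pos_of_pos hB (n + a)).ne'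
  have hYn : Yhat A B n = (besselJ (n + a) (2 / B) * Real.cos ((n + a) * Real.pi) -
      besselJ (-(n + a)) (2 / B)) / Real.sin ((n + a) * Real.pi) := by
    simp [Yhat, besselY, ha]
  have hJn : Jhat A B n = besselJ (n + a) (2 / B) := by simp [Jhat, ha]
  rw [Ups, hYn, hJn, hcos, hsin]
  have hsgn : ((-1 : ℝ) ^ n) ≠ 0 := by simp
  field_simp
  ring
end

section
/- Let λ ≥ 0, set α = 1/(2+λ) and γ̂ = −λ/(2+λ), and define N = ((2α−1)·e^{−2α})/Γ(γ̂+1) + (1/2)·(√2·α)^{1−γ̂}·J_{1+γ̂}(2√2·α) + 𝒮_λ and D = ((2α−1)·e^{−2α})/Γ(γ̂+1) + (1/2)·(√2·α)^{1−γ̂}·(J_{1+γ̂}(2√2·α) + 2√2·J_{2+γ̂}(2√2·α)) + 𝒮_λ. Then D ≠ 0 and d_n/c_n converges to N/D as n → ∞. -/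
open Filter Topology

section AdjointSolution

/-- The reciprocal Gamma values `1 / Γ(m + 2a)`. -/
noncomputable def rgam (a : ℝ) (m : ℕ) : ℝ := (Real.Gamma (m + 2 * a))⁻¹

/-- The general term of the Bessel-type series `besselCoeff`. -/
noncomputable def besselTerm (a : ℝ) (n k : ℕ) : ℝ :=
  (-(2 * a)) ^ k / k.factorial * (a ^ (k + n) * rgam a (k + n + 1))

/-- The Bessel-type series `∑ₖ (-2a)^k a^(k+n) / (k! Γ(k+n+1+2a))`. -/
noncomputable def besselCoeff (a : ℝ) (n : ℕ) : ℝ := ∑' k : ℕ, besselTerm a n k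

/-- The minimal solution of the adjoint recurrence. -/
noncomputable def adjSol (a : ℝ) (n : ℕ) : ℝ := ∑' j : ℕ, ((j : ℝ) + 1) * besselCoeff a (n + j)

variable {a : ℝ}

lemma rgam_pos (ha : 0 < a) (m : ℕ) : 0 < rgam a m :=
  inv_pos.2 (Real.Gamma_pos_of_pos (by positivity))

lemma rgam_succ (ha : 0 < a) (m : ℕ) : rgam a m = (m + 2 * a) * rgam a (m + 1) := by
  have h : (m : ℝ) + 2 * a ≠ 0 := by positivity
  have h2 := Real.Gamma_add_one h
  have h3 : Real.Gamma ((m : ℝ) + 2 * a) ≠ 0 := (Real.Gamma_pos_of_pos (by positivity)).ne'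
  unfold rgam
  rw [show ((m + 1 : ℕ) : ℝ) + 2 * a = m + 2 * a + 1 by push_cast; ring, h2]
  field_simp

lemma rgam_succ_le (ha : 0 < a) (m : ℕ) : rgam a (m + 2) ≤ rgam a (m + 1) / (m + 1) := by
  rw [rgam_succ ha (m + 1), le_div_iff₀ (by positivity)]
  have := rgam_pos ha (m + 2)
  push_cast
  nlinarith

lemma rgam_antitone (ha : 0 < a) : Antitone fun m => rgam a (m + 1) := by
  refine antitone_nat_of_succ_le fun m => (rgam_succ_le ha m).trans ?_
  exact div_le_self (rgam_pos ha _).le (by simp)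

lemma rgam_le (ha : 0 < a) (m : ℕ) : rgam a m ≤ rgam a 0 + rgam a 1 := by
  have h0 := rgam_pos ha 0
  have h1 := rgam_pos ha 1
  rcases m with _ | m
  · linarith
  · have := rgam_antitone ha (Nat.zero_le m)
    simp only [zero_add] at this
    linarith

lemma abs_besselTerm (ha : 0 < a) (n k : ℕ) :
    |besselTerm a n k| = a ^ n * ((2 * a ^ 2) ^ k / k.factorial) * rgam a (k + n + 1) := by
  have := rgam_pos ha (k + n + 1)
  unfold besselTerm
  rw [abs_mul, abs_div, abs_pow, abs_neg, abs_of_pos (show 0 < 2 * a by positivity),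
    abs_of_pos (show 0 < a ^ (k + n) * rgam a (k + n + 1) by positivity), Nat.abs_cast,
    mul_pow, mul_pow, pow_add, ← pow_mul, mul_comm 2 k, pow_mul]
  ring

lemma hasSum_exp (x : ℝ) : HasSum (fun k : ℕ => x ^ k / k.factorial) (Real.exp x) := by
  rw [Real.exp_eq_exp_ℝ]
  exact NormedSpace.expSeries_div_hasSum_exp x

lemma summable_besselTerm (ha : 0 < a) (n : ℕ) : Summable (besselTerm a n) := by
  refine Summable.of_norm_bounded
    (((hasSum_exp (2 * a ^ 2)).summable.mul_left (a ^ n)).mul_right (rgam a (n + 1))) fun k => ?_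
  rw [Real.norm_eq_abs, abs_besselTerm ha]
  exact mul_le_mul_of_nonneg_left (rgam_antitone ha (Nat.le_add_left n k)) (by positivity)

lemma exp_two_sq_le (ha : 0 < a) (ha2 : a ≤ 1 / 2) : Real.exp (2 * a ^ 2) ≤ 3 := by
  have : Real.exp (2 * a ^ 2) ≤ Real.exp 1 := Real.exp_le_exp.2 (by nlinarith)
  linarith [Real.exp_one_lt_d9]

lemma abs_besselCoeff_sub_le (ha : 0 < a) (ha2 : a ≤ 1 / 2) (n : ℕ) :
    |besselCoeff a n - a ^ n * rgam a (n + 1)| ≤ a ^ n * rgam a (n + 1) * (3 / (n + 1)) := by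
  have hs := summable_besselTerm ha n
  have h0 : besselTerm a n 0 = a ^ n * rgam a (n + 1) := by simp [besselTerm]
  have hE := (hasSum_exp (2 * a ^ 2)).summable
  have hr := rgam_pos ha (n + 1)
  rw [besselCoeff, hs.tsum_eq_zero_add, h0, add_sub_cancel_left]
  have hb : ∀ k, ‖besselTerm a n (k + 1)‖ ≤
      (a ^ n * rgam a (n + 1) / (n + 1)) * ((2 * a ^ 2) ^ (k + 1) / (k + 1).factorial) := by
    intro k
    rw [Real.norm_eq_abs, abs_besselTerm ha]
    have h1 : rgam a (k + 1 + n + 1) ≤ rgam a (n + 1) / (n + 1) :=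
      (rgam_antitone ha (show n + 1 ≤ k + 1 + n by omega)).trans (rgam_succ_le ha n)
    calc _ ≤ a ^ n * ((2 * a ^ 2) ^ (k + 1) / (k + 1).factorial) * (rgam a (n + 1) / (n + 1)) :=
          mul_le_mul_of_nonneg_left h1 (by positivity)
      _ = _ := by ring
  have hE1 := (summable_nat_add_iff 1).2 hE
  have h2 := tsum_of_norm_bounded (hE1.mul_left _).hasSum hb
  rw [Real.norm_eq_abs, tsum_mul_left] at h2
  refine h2.trans ?_
  have h3 : ∑' k : ℕ, (2 * a ^ 2) ^ (k + 1) / ((k + 1).factorial : ℝ) ≤ 3 := by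
    have h4 := hE.tsum_eq_zero_add
    rw [(hasSum_exp _).tsum_eq] at h4
    simp only [pow_zero, Nat.factorial_zero, Nat.cast_one, div_one] at h4
    linarith [exp_two_sq_le ha ha2]
  calc _ ≤ (a ^ n * rgam a (n + 1) / (n + 1)) * 3 :=
        mul_le_mul_of_nonneg_left h3 (by positivity)
    _ = _ := by ring

lemma abs_besselCoeff_le (ha : 0 < a) (ha2 : a ≤ 1 / 2) (n : ℕ) :
    |besselCoeff a n| ≤ 4 * rgam a 1 * (1 / 2) ^ n := by
  have h := abs_le.1 (abs_besselCoeff_sub_le ha ha2 n)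
  have hr := rgam_pos ha (n + 1)
  have hr1 : rgam a (n + 1) ≤ rgam a 1 := rgam_antitone ha (Nat.zero_le n)
  have h3 : (3 : ℝ) / (n + 1) ≤ 3 := div_le_self (by norm_num) (by simp)
  have hX : a ^ n * rgam a (n + 1) ≤ rgam a 1 * (1 / 2) ^ n := by
    rw [mul_comm]
    exact mul_le_mul hr1 (pow_le_pow_left₀ ha.le ha2 n) (by positivity) (hr.le.trans hr1)
  have hX0 : 0 < a ^ n * rgam a (n + 1) := by positivity
  have := mul_le_mul_of_nonneg_left h3 hX0.le
  rw [abs_le]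
  constructor <;> linarith [h.1, h.2]

lemma besselCoeff_bounds (ha : 0 < a) (ha2 : a ≤ 1 / 2) {n : ℕ} (hn : 5 ≤ n) :
    1 / 2 * (a ^ n * rgam a (n + 1)) ≤ besselCoeff a n ∧
      besselCoeff a n ≤ 3 / 2 * (a ^ n * rgam a (n + 1)) := by
  have h := abs_le.1 (abs_besselCoeff_sub_le ha ha2 n)
  have hr := rgam_pos ha (n + 1)
  have hn' : (5 : ℝ) ≤ n := by exact_mod_cast hn
  have h3 : (3 : ℝ) / (n + 1) ≤ 1 / 2 := by
    rw [div_le_div_iff₀ (by positivity) (by norm_num)]; linarith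
  have hX0 : 0 < a ^ n * rgam a (n + 1) := by positivity
  have := mul_le_mul_of_nonneg_left h3 hX0.le
  constructor <;> linarith [h.1, h.2]

lemma besselCoeff_pos (ha : 0 < a) (ha2 : a ≤ 1 / 2) {n : ℕ} (hn : 5 ≤ n) :
    0 < besselCoeff a n := by
  have := (besselCoeff_bounds ha ha2 hn).1
  have hr := rgam_pos ha (n + 1)
  have hX0 : 0 < a ^ n * rgam a (n + 1) := by positivity
  linarith

lemma besselCoeff_succ_le (ha : 0 < a) (ha2 : a ≤ 1 / 2) {n : ℕ} (hn : 5 ≤ n) :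
    besselCoeff a (n + 1) ≤ 3 / 2 / (n + 1) * besselCoeff a n := by
  have h1 := (besselCoeff_bounds ha ha2 (show 5 ≤ n + 1 by omega)).2
  have h2 := (besselCoeff_bounds ha ha2 hn).1
  have hr := rgam_pos ha (n + 1)
  have hr2 := rgam_pos ha (n + 2)
  have hX : a ^ (n + 1) * rgam a (n + 2) ≤ 1 / 2 * a ^ n * (rgam a (n + 1) / (n + 1)) := by
    refine mul_le_mul ?_ (rgam_succ_le ha n) hr2.le (by positivity)
    rw [pow_succ, mul_comm]
    exact mul_le_mul_of_nonneg_right ha2 (by positivity)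
  calc besselCoeff a (n + 1) ≤ 3 / 2 * (1 / 2 * a ^ n * (rgam a (n + 1) / (n + 1))) := by
        linarith
    _ = 3 / 2 / (n + 1) * (1 / 2 * (a ^ n * rgam a (n + 1))) := by ring
    _ ≤ _ := mul_le_mul_of_nonneg_left h2 (by positivity)

lemma besselCoeff_add_le (ha : 0 < a) (ha2 : a ≤ 1 / 2) {n : ℕ} (hn : 5 ≤ n) (j : ℕ) :
    besselCoeff a (n + j) ≤ (1 / 4) ^ j * besselCoeff a n := by
  induction j with
  | zero => simp
  | succ j ih =>
    have h := besselCoeff_succ_le ha ha2 (show 5 ≤ n + j by omega)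
    have hp := besselCoeff_pos ha ha2 (show 5 ≤ n + j by omega)
    have hn' : (5 : ℝ) ≤ ((n + j : ℕ) : ℝ) := by exact_mod_cast (show 5 ≤ n + j by omega)
    have h3 : (3 : ℝ) / 2 / (((n + j : ℕ) : ℝ) + 1) ≤ 1 / 4 := by
      rw [div_le_div_iff₀ (by positivity) (by norm_num)]; linarith
    rw [← add_assoc, pow_succ]
    nlinarith [mul_le_mul_of_nonneg_right h3 hp.le]

lemma summable_besselCoeff (ha : 0 < a) (ha2 : a ≤ 1 / 2) (n : ℕ) :
    Summable fun j => besselCoeff a (n + j) := by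
  refine Summable.of_norm_bounded (g := fun j => 4 * rgam a 1 * (1 / 2) ^ n * (1 / 2) ^ j)
    ((summable_geometric_of_lt_one (by norm_num) (by norm_num)).mul_left _) fun j => ?_
  rw [Real.norm_eq_abs, mul_assoc, ← pow_add]
  exact abs_besselCoeff_le ha ha2 _

lemma summable_mul_besselCoeff (ha : 0 < a) (ha2 : a ≤ 1 / 2) (n : ℕ) :
    Summable fun j : ℕ => (j : ℝ) * besselCoeff a (n + j) := by
  have h := summable_pow_mul_geometric_of_norm_lt_one 1 (r := (1 / 2 : ℝ)) (by norm_num)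
  refine Summable.of_norm_bounded (h.mul_left (4 * rgam a 1 * (1 / 2) ^ n)) fun j => ?_
  rw [Real.norm_eq_abs, abs_mul, Nat.abs_cast, pow_one]
  calc _ ≤ (j : ℝ) * (4 * rgam a 1 * (1 / 2) ^ (n + j)) :=
        mul_le_mul_of_nonneg_left (abs_besselCoeff_le ha ha2 _) (by positivity)
    _ = _ := by rw [pow_add]; ring

lemma summable_adjSol (ha : 0 < a) (ha2 : a ≤ 1 / 2) (n : ℕ) :
    Summable fun j : ℕ => ((j : ℝ) + 1) * besselCoeff a (n + j) := by
  simpa [add_mul] using (summable_mul_besselCoeff ha ha2 n).add (summable_besselCoeff ha ha2 n)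

lemma tsum_besselCoeff (ha : 0 < a) (ha2 : a ≤ 1 / 2) (n : ℕ) :
    ∑' j, besselCoeff a (n + j) = besselCoeff a n + ∑' j, besselCoeff a (n + 1 + j) := by
  rw [(summable_besselCoeff ha ha2 n).tsum_eq_zero_add]
  congr 1
  exact tsum_congr fun j => by rw [add_assoc n 1 j, add_comm 1 j]

lemma adjSol_sub_succ (ha : 0 < a) (ha2 : a ≤ 1 / 2) (n : ℕ) :
    adjSol a n - adjSol a (n + 1) = ∑' j, besselCoeff a (n + j) := by
  have h1 := (summable_adjSol ha ha2 n).tsum_eq_zero_add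
  have h3 := (summable_adjSol ha ha2 (n + 1)).tsum_add (summable_besselCoeff ha ha2 (n + 1))
  have h4 : ∑' j : ℕ, (((j + 1 : ℕ) : ℝ) + 1) * besselCoeff a (n + (j + 1)) =
      ∑' j : ℕ, (((j : ℝ) + 1) * besselCoeff a (n + 1 + j) + besselCoeff a (n + 1 + j)) := by
    refine tsum_congr fun j => ?_
    rw [add_assoc n 1 j, add_comm 1 j]; push_cast; ring
  rw [h4, h3] at h1
  simp only [adjSol]
  rw [h1, tsum_besselCoeff ha ha2 n]
  simp only [Nat.cast_zero, zero_add, one_mul, add_zero]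
  ring

lemma adjSol_second_diff (ha : 0 < a) (ha2 : a ≤ 1 / 2) (n : ℕ) :
    adjSol a n - 2 * adjSol a (n + 1) + adjSol a (n + 2) = besselCoeff a n := by
  have h1 := adjSol_sub_succ ha ha2 n
  have h2 := adjSol_sub_succ ha ha2 (n + 1)
  have h3 := tsum_besselCoeff ha ha2 n
  rw [add_assoc n 1 1] at h2
  norm_num at h2
  linarith

lemma le_adjSol (ha : 0 < a) (ha2 : a ≤ 1 / 2) {n : ℕ} (hn : 5 ≤ n) :
    besselCoeff a n ≤ adjSol a n := by
  have h := (summable_adjSol ha ha2 n).le_tsum 0 fun j _ =>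
    mul_nonneg (by positivity) (besselCoeff_pos ha ha2 (show 5 ≤ n + j by omega)).le
  simpa [adjSol] using h

lemma adjSol_le (ha : 0 < a) (ha2 : a ≤ 1 / 2) {n : ℕ} (hn : 5 ≤ n) :
    adjSol a n ≤ 2 * besselCoeff a n := by
  have h1 := hasSum_coe_mul_geometric_of_norm_lt_one (r := (1 / 4 : ℝ)) (by norm_num)
  have h2 := hasSum_geometric_of_lt_one (r := (1 / 4 : ℝ)) (by norm_num) (by norm_num)
  have h3 := (h1.add h2).mul_right (besselCoeff a n)
  have hB := besselCoeff_pos ha ha2 hn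
  have h4 := hasSum_le (fun j => ?_) (summable_adjSol ha ha2 n).hasSum h3
  · refine h4.trans (mul_le_mul_of_nonneg_right (by norm_num) hB.le)
  · have := mul_le_mul_of_nonneg_left (besselCoeff_add_le ha ha2 hn j)
      (show (0 : ℝ) ≤ (j : ℝ) + 1 by positivity)
    linarith

lemma besselCoeff_rec (ha : 0 < a) (n : ℕ) :
    a * besselCoeff a n + 2 * a * besselCoeff a (n + 2) =
      (n + 1 + 2 * a) * besselCoeff a (n + 1) := by
  have s0 := summable_besselTerm ha n
  have s1 := summable_besselTerm ha (n + 1)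
  have s2 := summable_besselTerm ha (n + 2)
  have hk : ∀ k : ℕ, (k : ℝ) * besselTerm a (n + 1) k =
      a * besselTerm a n k - (n + 1 + 2 * a) * besselTerm a (n + 1) k := by
    intro k
    have h := rgam_succ ha (k + n + 1)
    simp only [besselTerm, ← add_assoc]
    rw [h]
    push_cast
    ring
  have hsk : Summable fun k : ℕ => (k : ℝ) * besselTerm a (n + 1) k := by
    simp only [hk]
    exact (s0.mul_left _).sub (s1.mul_left _)
  have h1 : ∑' k : ℕ, (k : ℝ) * besselTerm a (n + 1) k = -(2 * a) * besselCoeff a (n + 2) := by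
    rw [hsk.tsum_eq_zero_add, besselCoeff, ← tsum_mul_left]
    simp only [Nat.cast_zero, zero_mul, zero_add]
    refine tsum_congr fun k => ?_
    have hf : (k.factorial : ℝ) ≠ 0 := by positivity
    simp only [besselTerm, Nat.factorial_succ]
    rw [show k + 1 + (n + 1) = k + (n + 2) by ring]
    push_cast
    field_simp
    ring
  simp only [hk] at h1
  rw [(s0.mul_left _).tsum_sub (s1.mul_left _), tsum_mul_left, tsum_mul_left] at h1
  simp only [besselCoeff] at h1 ⊢
  linarith

lemma adjSol_pos (ha : 0 < a) (ha2 : a ≤ 1 / 2) {n : ℕ} (hn : 5 ≤ n) : 0 < adjSol a n :=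
  (besselCoeff_pos ha ha2 hn).trans_le (le_adjSol ha ha2 hn)

lemma adjSol_succ_le (ha : 0 < a) (ha2 : a ≤ 1 / 2) {n : ℕ} (hn : 5 ≤ n) :
    adjSol a (n + 1) ≤ 3 / (n + 1) * adjSol a n := by
  have h1 := adjSol_le ha ha2 (show 5 ≤ n + 1 by omega)
  have h2 := besselCoeff_succ_le ha ha2 hn
  calc adjSol a (n + 1) ≤ 2 * (3 / 2 / (n + 1) * besselCoeff a n) := by linarith
    _ = 3 / (n + 1) * besselCoeff a n := by ring
    _ ≤ _ := mul_le_mul_of_nonneg_left (le_adjSol ha ha2 hn) (by positivity)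

lemma adjSol_succ_le_self (ha : 0 < a) (ha2 : a ≤ 1 / 2) {n : ℕ} (hn : 5 ≤ n) :
    adjSol a (n + 1) ≤ adjSol a n := by
  have hn' : (5 : ℝ) ≤ n := by exact_mod_cast hn
  refine (adjSol_succ_le ha ha2 hn).trans
    (mul_le_of_le_one_left (adjSol_pos ha ha2 hn).le ?_)
  rw [div_le_one (by positivity)]
  linarith

lemma tendsto_adjSol (ha : 0 < a) (ha2 : a ≤ 1 / 2) : Tendsto (adjSol a) atTop (𝓝 0) := by
  have h : Tendsto (besselCoeff a) atTop (𝓝 0) := by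
    simpa using (summable_besselCoeff ha ha2 0).tendsto_atTop_zero
  have h2 := h.const_mul 2
  rw [mul_zero] at h2
  refine squeeze_zero' ?_ ?_ h2
  · filter_upwards [eventually_ge_atTop 5] with n hn using (adjSol_pos ha ha2 hn).le
  · filter_upwards [eventually_ge_atTop 5] with n hn using adjSol_le ha ha2 hn

lemma tendsto_mul_adjSol (ha : 0 < a) (ha2 : a ≤ 1 / 2) :
    Tendsto (fun n : ℕ => ((n : ℝ) + 1) * adjSol a (n + 1)) atTop (𝓝 0) := by
  have h2 := (tendsto_adjSol ha ha2).const_mul 3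
  rw [mul_zero] at h2
  refine squeeze_zero' ?_ ?_ h2
  · filter_upwards [eventually_ge_atTop 5] with n hn
    exact mul_nonneg (by positivity) (adjSol_pos ha ha2 (show 5 ≤ n + 1 by omega)).le
  · filter_upwards [eventually_ge_atTop 5] with n hn
    have h := adjSol_succ_le ha ha2 hn
    rw [div_mul_eq_mul_div, le_div_iff₀ (by positivity)] at h
    linarith

lemma eq_zero_of_second_diff_eq_zero {F : ℕ → ℝ} (h : ∀ n, F n - 2 * F (n + 1) + F (n + 2) = 0)
    (hF : Tendsto F atTop (𝓝 0)) (n : ℕ) : F n = 0 := by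
  have hd : ∀ n, F (n + 1) - F n = F 1 - F 0 := fun n => by
    induction n with
    | zero => rfl
    | succ n ih => linarith [h n]
  have hd0 : F 1 - F 0 = 0 := by
    have h1 := (hF.comp (tendsto_add_atTop_nat 1)).sub hF
    simp only [Function.comp_def, hd, sub_zero] at h1
    exact tendsto_nhds_unique tendsto_const_nhds h1
  have hc : ∀ n, F n = F 0 := fun n => by
    induction n with
    | zero => rfl
    | succ n ih => linarith [hd n]
  have hF0 : F 0 = 0 := by
    have h1 := hF
    rw [show F = fun _ => F 0 from funext hc] at h1
    exact tendsto_nhds_unique tendsto_const_nhds h1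
  rw [hc, hF0]

lemma adjSol_rec (ha : 0 < a) (ha2 : a ≤ 1 / 2) (n : ℕ) :
    a * adjSol a n = (n + 1 + 3 * a) * adjSol a (n + 1) - (n + 4 * a) * adjSol a (n + 2) +
      2 * a * adjSol a (n + 3) := by
  have key := eq_zero_of_second_diff_eq_zero
    (F := fun n : ℕ => a * adjSol a n - (n + 1 + 3 * a) * adjSol a (n + 1) +
      (n + 4 * a) * adjSol a (n + 2) - 2 * a * adjSol a (n + 3)) ?_ ?_ n
  · linarith
  · intro n
    have d0 := adjSol_second_diff ha ha2 n
    have d1 := adjSol_second_diff ha ha2 (n + 1)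
    have d2 := adjSol_second_diff ha ha2 (n + 2)
    have d3 := adjSol_second_diff ha ha2 (n + 3)
    have r0 := besselCoeff_rec ha n
    have r1 := besselCoeff_rec ha (n + 1)
    rw [← d0, ← d1, ← d2] at r0
    rw [← d1, ← d2, ← d3] at r1
    simp only [add_assoc, Nat.reduceAdd] at r0 r1 ⊢
    push_cast at r0 r1 ⊢
    linear_combination r0 - r1
  · have t := tendsto_adjSol ha ha2
    have t' := tendsto_mul_adjSol ha ha2
    have T := (((t.const_mul a).sub (t'.add
      ((t.comp (tendsto_add_atTop_nat 1)).const_mul (3 * a)))).add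
      ((t'.comp (tendsto_add_atTop_nat 1)).add
      ((t.comp (tendsto_add_atTop_nat 2)).const_mul (4 * a - 2)))).sub
      ((t.comp (tendsto_add_atTop_nat 3)).const_mul (2 * a))
    simp only [mul_zero, add_zero, sub_zero] at T
    refine T.congr fun n => ?_
    simp only [Function.comp_apply]
    push_cast
    ring_nf

end AdjointSolution

section DoubleSeries

variable {a : ℝ}

lemma hasSum_mul_exp (x : ℝ) :
    HasSum (fun k : ℕ => (k : ℝ) * (x ^ k / k.factorial)) (x * Real.exp x) := by
  rw [← hasSum_nat_add_iff' 1]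
  simp only [Finset.range_one, Finset.sum_singleton, Nat.cast_zero, zero_mul, sub_zero]
  refine ((hasSum_exp x).mul_left x).congr_fun fun k => ?_
  rw [Nat.factorial_succ]
  push_cast
  field_simp
  ring

/-- The general term of the full double series behind `𝒮`. -/
noncomputable def dblTerm (a : ℝ) (k m : ℕ) : ℝ :=
  (-(2 * a)) ^ k / k.factorial * (a ^ m * rgam a m) * (k + 1 + a - m)

lemma summable_pow_mul_rgam (ha : 0 < a) (ha2 : a ≤ 1 / 2) :
    Summable fun m : ℕ => a ^ m * rgam a m := by
  refine Summable.of_norm_bounded ((summable_geometric_of_lt_one (r := a) ha.le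
    (by linarith)).mul_right (rgam a 0 + rgam a 1)) fun m => ?_
  have := rgam_pos ha m
  rw [Real.norm_of_nonneg (by positivity)]
  exact mul_le_mul_of_nonneg_left (rgam_le ha m) (by positivity)

lemma summable_nat_mul_rgam (ha : 0 < a) (ha2 : a ≤ 1 / 2) :
    Summable fun m : ℕ => (m : ℝ) * (a ^ m * rgam a m) := by
  have h := summable_pow_mul_geometric_of_norm_lt_one 1 (r := a)
    (by rw [Real.norm_of_nonneg ha.le]; linarith)
  refine Summable.of_norm_bounded (h.mul_right (rgam a 0 + rgam a 1)) fun m => ?_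
  have := rgam_pos ha m
  rw [Real.norm_of_nonneg (by positivity), ← mul_assoc, pow_one]
  exact mul_le_mul_of_nonneg_left (rgam_le ha m) (by positivity)

lemma tsum_nat_mul_rgam (ha : 0 < a) (ha2 : a ≤ 1 / 2) :
    ∑' m : ℕ, (m : ℝ) * (a ^ m * rgam a m) =
      (2 * a - 1) * rgam a 0 + (1 - a) * ∑' m : ℕ, a ^ m * rgam a m := by
  have s0 := summable_pow_mul_rgam ha ha2
  have s1 := summable_nat_mul_rgam ha ha2
  have h1 := (s1.add (s0.mul_left (2 * a - 1))).tsum_eq_zero_add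
  rw [s1.tsum_add (s0.mul_left _), tsum_mul_left] at h1
  have h2 : ∑' m : ℕ, (((m + 1 : ℕ) : ℝ) * (a ^ (m + 1) * rgam a (m + 1)) +
      (2 * a - 1) * (a ^ (m + 1) * rgam a (m + 1))) = a * ∑' m : ℕ, a ^ m * rgam a m := by
    rw [← tsum_mul_left]
    refine tsum_congr fun m => ?_
    rw [rgam_succ ha m]
    push_cast
    ring
  rw [h2] at h1
  simp only [Nat.cast_zero, zero_mul, pow_zero, one_mul, zero_add] at h1
  linarith

lemma summable_dblTerm (ha : 0 < a) (ha2 : a ≤ 1 / 2) :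
    Summable fun p : ℕ × ℕ => dblTerm a p.1 p.2 := by
  have hu : Summable fun k : ℕ => (k : ℝ) * ((2 * a) ^ k / k.factorial) +
      2 * ((2 * a) ^ k / k.factorial) :=
    (hasSum_mul_exp (2 * a)).summable.add ((hasSum_exp (2 * a)).summable.mul_left 2)
  have hv := (summable_nat_mul_rgam ha ha2).add (summable_pow_mul_rgam ha ha2)
  have hr := fun m => rgam_pos ha m
  refine Summable.of_norm_bounded (hu.mul_of_nonneg hv (fun k => ?_) (fun m => ?_)) fun p => ?_
  · simp only [Pi.zero_apply]
    positivity
  · have := hr m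
    simp only [Pi.zero_apply]
    positivity
  · obtain ⟨k, m⟩ := p
    have := hr m
    have h1 : |(k : ℝ) + 1 + a - m| ≤ (k + 2) * (m + 1) := by
      have hk : (0 : ℝ) ≤ k := by positivity
      have hm : (0 : ℝ) ≤ m := by positivity
      rw [abs_le]
      constructor <;> nlinarith [mul_nonneg hk hm]
    simp only [dblTerm, Real.norm_eq_abs]
    rw [abs_mul, abs_mul, abs_div, abs_pow, abs_neg, abs_of_pos (show 0 < 2 * a by positivity),
      Nat.abs_cast, abs_of_pos (show 0 < a ^ m * rgam a m by positivity)]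
    refine (mul_le_mul_of_nonneg_left h1 (by positivity)).trans (le_of_eq ?_)
    ring

lemma tsum_dblTerm (ha : 0 < a) (ha2 : a ≤ 1 / 2) :
    ∑' k : ℕ, ∑' m : ℕ, dblTerm a k m = (1 - 2 * a) * rgam a 0 * Real.exp (-(2 * a)) := by
  have s0 := summable_pow_mul_rgam ha ha2
  have s1 := summable_nat_mul_rgam ha ha2
  set E := ∑' m : ℕ, a ^ m * rgam a m with hE
  have hin : ∀ k : ℕ, ∑' m : ℕ, dblTerm a k m =
      (k : ℝ) * ((-(2 * a)) ^ k / k.factorial) * E +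
        (-(2 * a)) ^ k / k.factorial * (2 * a * E + (1 - 2 * a) * rgam a 0) := by
    intro k
    have h : ∀ m, dblTerm a k m = (-(2 * a)) ^ k / k.factorial *
        ((k + 1 + a) * (a ^ m * rgam a m) - m * (a ^ m * rgam a m)) := fun m => by
      unfold dblTerm; ring
    simp only [h]
    rw [tsum_mul_left, (s0.mul_left _).tsum_sub s1, tsum_mul_left, tsum_nat_mul_rgam ha ha2, ← hE]
    ring
  simp only [hin]
  rw [(((hasSum_mul_exp (-(2 * a))).mul_right E).add
    ((hasSum_exp (-(2 * a))).mul_right _)).tsum_eq]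
  ring

lemma hasSum_lower_dblTerm (ha : 0 < a) (ha2 : a ≤ 1 / 2) :
    HasSum (fun k : ℕ => ∑ m ∈ Finset.range (k + 1), dblTerm a k m)
      (∑' j : ℕ, ∑' m : ℕ, dblTerm a (j + m) m) := by
  have hs : Summable fun p : ℕ × ℕ => dblTerm a (p.1 + p.2) p.2 :=
    (summable_dblTerm ha ha2).comp_injective (i := fun p : ℕ × ℕ => (p.1 + p.2, p.2)) (by
      rintro ⟨x, y⟩ ⟨z, w⟩ h
      simp only [Prod.mk.injEq] at h ⊢
      omega)
  rw [← hs.tsum_prod]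
  have h := (Finset.HasAntidiagonal.sigmaAntidiagonalEquivProd (A := ℕ)).hasSum_iff.2 hs.hasSum
  have h2 := h.sigma fun k => (hasSum_fintype _)
  refine h2.congr_fun fun k => ?_
  simp only [Function.comp_apply, Finset.HasAntidiagonal.sigmaAntidiagonalEquivProd_apply]
  rw [Finset.sum_coe_sort (Finset.HasAntidiagonal.antidiagonal k)
    (fun p : ℕ × ℕ => dblTerm a (p.1 + p.2) p.2), Finset.Nat.sum_antidiagonal_eq_sum_range_succ_mk,
    ← Finset.sum_range_reflect]
  refine Finset.sum_congr rfl fun m hm => ?_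
  have := Finset.mem_range.1 hm
  congr 1; omega

lemma hasSum_upper_dblTerm (ha : 0 < a) (ha2 : a ≤ 1 / 2) :
    HasSum (fun k : ℕ => ∑' j : ℕ, dblTerm a k (j + (k + 1)))
      (a ^ 2 * (adjSol a 0 - adjSol a 1) - a * adjSol a 1) := by
  have hs : Summable fun p : ℕ × ℕ => dblTerm a p.1 (p.2 + (p.1 + 1)) :=
    (summable_dblTerm ha ha2).comp_injective (i := fun p : ℕ × ℕ => (p.1, p.2 + (p.1 + 1))) (by
      rintro ⟨x, y⟩ ⟨z, w⟩ h
      simp only [Prod.mk.injEq] at h ⊢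
      omega)
  have hterm : ∀ k j, dblTerm a k (j + (k + 1)) = besselTerm a j k * (a * (a - j)) := by
    intro k j
    unfold dblTerm besselTerm
    rw [show j + (k + 1) = k + j + 1 by ring]
    push_cast
    ring
  have h0 : ∑' j : ℕ, (j : ℝ) * besselCoeff a j = adjSol a 1 := by
    have := summable_mul_besselCoeff ha ha2 0
    simp only [zero_add] at this
    rw [this.tsum_eq_zero_add]
    simp only [Nat.cast_zero, zero_mul, zero_add, adjSol]
    exact tsum_congr fun j => by rw [add_comm 1 j]; push_cast; ring
  have hsum : ∑' k : ℕ, ∑' j : ℕ, dblTerm a k (j + (k + 1)) =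
      a ^ 2 * (adjSol a 0 - adjSol a 1) - a * adjSol a 1 := by
    rw [← Summable.tsum_comm (f := fun k j => dblTerm a k (j + (k + 1))) hs]
    simp only [hterm, tsum_mul_right]
    have h1 := summable_besselCoeff ha ha2 0
    have h2 := summable_mul_besselCoeff ha ha2 0
    have h3 := adjSol_sub_succ ha ha2 0
    simp only [zero_add] at h1 h2 h3
    rw [h3, ← h0, ← tsum_mul_left, ← tsum_mul_left,
      ← (h1.mul_left _).tsum_sub (h2.mul_left _)]
    exact tsum_congr fun j => by rw [← besselCoeff]; ring
  rw [← hsum]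
  exact hs.prod.hasSum

lemma tsum_shifted_dblTerm (ha : 0 < a) (ha2 : a ≤ 1 / 2) :
    ∑' j : ℕ, ∑' m : ℕ, dblTerm a (j + m) m =
      (1 - 2 * a) * rgam a 0 * Real.exp (-(2 * a)) -
        (a ^ 2 * (adjSol a 0 - adjSol a 1) - a * adjSol a 1) := by
  rw [← tsum_dblTerm ha ha2, eq_sub_iff_add_eq,
    ← ((hasSum_lower_dblTerm ha ha2).add (hasSum_upper_dblTerm ha ha2)).tsum_eq]
  exact tsum_congr fun k =>
    ((summable_dblTerm ha ha2).prod_factor k).sum_add_tsum_nat_add (k + 1)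

end DoubleSeries

section ClosedForms

variable {a : ℝ}

lemma tsum_eq_tsum_dblTerm (a : ℝ) :
    (∑' j : ℕ, (-(2 * a)) ^ j * ((j : ℝ) + 1 + a) *
      ∑' m : ℕ, ((-1 : ℝ) ^ m * (2 * a ^ 2) ^ m /
        (Real.Gamma ((m : ℝ) + 1 + (2 * a - 1)) * Real.Gamma ((m : ℝ) + 1 + (j : ℝ))))) =
      ∑' j : ℕ, ∑' m : ℕ, dblTerm a (j + m) m := by
  refine tsum_congr fun j => ?_
  rw [← tsum_mul_left]
  refine tsum_congr fun m => ?_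
  unfold dblTerm rgam
  rw [show (m : ℝ) + 1 + (2 * a - 1) = m + 2 * a by ring,
    show (m : ℝ) + 1 + j = ((j + m : ℕ) : ℝ) + 1 by push_cast; ring,
    Real.Gamma_nat_eq_factorial, pow_add, neg_pow (2 * a) m, mul_pow 2 a, mul_pow 2 (a ^ 2)]
  push_cast
  ring

lemma rpow_mul_besselJ (ha : 0 < a) (p : ℕ) :
    (Real.sqrt 2 * a) ^ (1 - (2 * a - 1)) * besselJ (p + 1 + (2 * a - 1)) (2 * Real.sqrt 2 * a) =
      Real.sqrt 2 ^ (p + 2) * a ^ 2 * besselCoeff a p := by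
  unfold besselJ besselCoeff
  rw [← tsum_mul_left, ← tsum_mul_left]
  refine tsum_congr fun m => ?_
  have h2 : (0 : ℝ) < Real.sqrt 2 := by positivity
  have hz : 0 < Real.sqrt 2 * a := by positivity
  rw [show 2 * Real.sqrt 2 * a / 2 = Real.sqrt 2 * a by ring, mul_left_comm, ← Real.rpow_add hz,
    show 1 - (2 * a - 1) + (2 * (m : ℝ) + (p + 1 + (2 * a - 1))) = ((2 * m + (p + 2) : ℕ) : ℝ) by
      push_cast; ring, Real.rpow_natCast, mul_pow, pow_add (Real.sqrt 2), pow_mul,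
    Real.sq_sqrt (by norm_num)]
  unfold besselTerm rgam
  rw [show (m : ℝ) + (p + 1 + (2 * a - 1)) + 1 = ((m + p + 1 : ℕ) : ℝ) + 2 * a by
    push_cast; ring, neg_pow (2 * a) m, mul_pow 2 a]
  ring

end ClosedForms

section Recurrence

variable {a l : ℝ}

/-- The Casoratian-type pairing of `x` with the adjoint solution. -/
noncomputable def adjPairing (a l : ℝ) (x : ℕ → ℝ) (n : ℕ) : ℝ :=
  adjSol a (n + 3) * x (n + 3) +
    (-((2 + l) * (n + 2) + 4) * adjSol a (n + 4) + 2 * adjSol a (n + 5)) * x (n + 2) +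
    2 * adjSol a (n + 4) * x (n + 1)

lemma adjSol_rec' (hl : 0 ≤ l) (hal : a = 1 / (2 + l)) (n : ℕ) :
    adjSol a n = ((2 + l) * (n + 1) + 3) * adjSol a (n + 1) -
      ((2 + l) * n + 4) * adjSol a (n + 2) + 2 * adjSol a (n + 3) := by
  have hl2 : 0 < 2 + l := by linarith
  have ha : 0 < a := by rw [hal]; positivity
  have ha2 : a ≤ 1 / 2 := by
    rw [hal]; exact one_div_le_one_div_of_le (by norm_num) (by linarith)
  have hla : (2 + l) * a = 1 := by rw [hal]; field_simp
  have h := adjSol_rec ha ha2 n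
  linear_combination (2 + l) * h + (-adjSol a n + 3 * adjSol a (n + 1) - 4 * adjSol a (n + 2)
    + 2 * adjSol a (n + 3)) * hla

lemma adjPairing_eq (hl : 0 ≤ l) (hal : a = 1 / (2 + l)) {x : ℕ → ℝ}
    (hx : ∀ n : ℕ, x (n + 4) = ((2 + l) * (n + 4) + 3) * x (n + 3) -
      ((2 + l) * (n + 2) + 4) * x (n + 2) + 2 * x (n + 1)) (n : ℕ) :
    adjPairing a l x n = adjPairing a l x 0 := by
  induction n with
  | zero => rfl
  | succ n ih =>
    rw [← ih]
    have h1 := hx n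
    have h2 := adjSol_rec' hl hal (n + 3)
    unfold adjPairing
    simp only [show n + 1 + 3 = n + 4 by omega, show n + 1 + 4 = n + 5 by omega,
      show n + 1 + 5 = n + 6 by omega, show n + 1 + 2 = n + 3 by omega,
      show n + 1 + 1 = n + 2 by omega] at h2 ⊢
    push_cast at h2 ⊢
    linear_combination adjSol a (n + 4) * h1 - x (n + 3) * h2

lemma growth (hl : 0 ≤ l) {x : ℕ → ℝ}
    (hx : ∀ n : ℕ, x (n + 4) = ((2 + l) * (n + 4) + 3) * x (n + 3) -
      ((2 + l) * (n + 2) + 4) * x (n + 2) + 2 * x (n + 1))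
    (h1 : 0 < x 1) (h2 : 2 * x 1 ≤ x 2) (h3 : 3 * x 2 ≤ x 3) (n : ℕ) :
    0 < x (n + 1) ∧ (n + 2) * x (n + 1) ≤ x (n + 2) ∧ (n + 3) * x (n + 2) ≤ x (n + 3) := by
  induction n with
  | zero => norm_num; exact ⟨h1, h2, h3⟩
  | succ n ih =>
    obtain ⟨i1, i2, i3⟩ := ih
    have hn : (0 : ℝ) ≤ n := by positivity
    have p2 : 0 < x (n + 2) := lt_of_lt_of_le (by positivity) i2
    have p3 : 0 < x (n + 3) := lt_of_lt_of_le (by positivity) i3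
    have e := hx n
    have h32 : x (n + 2) ≤ x (n + 3) / 3 := by nlinarith
    have hm := mul_le_mul_of_nonneg_left h32
      (show (0 : ℝ) ≤ (2 + l) * (n + 2) + 4 by positivity)
    simp only [show n + 1 + 3 = n + 4 by omega,
      show n + 1 + 2 = n + 3 by omega,
      show n + 1 + 1 = n + 2 by omega]
    push_cast
    refine ⟨p2, by linarith, ?_⟩
    have : (n + 4) * x (n + 3) ≤ ((2 + l) * (n + 4) + 3) * x (n + 3) -
        ((2 + l) * (n + 2) + 4) * (x (n + 3) / 3) := by
      have : 0 ≤ (((2 + l) * (n + 4) + 3) - ((2 + l) * (n + 2) + 4) / 3 - (n + 4)) * x (n + 3) := by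
        refine mul_nonneg ?_ p3.le
        nlinarith [mul_nonneg hl hn]
      linarith
    linarith

lemma tendsto_adjPairing_div (hl : 0 ≤ l) (hal : a = 1 / (2 + l)) {x c : ℕ → ℝ}
    (hc : ∀ n : ℕ, 0 < c (n + 1) ∧ (n + 2) * c (n + 1) ≤ c (n + 2))
    (hxc : ∀ n : ℕ, |x (n + 1)| ≤ c (n + 1)) :
    Tendsto (fun n => adjPairing a l x n / (adjSol a (n + 3) * c (n + 3)) -
      x (n + 3) / c (n + 3)) atTop (𝓝 0) := by
  have hl2 : 0 < 2 + l := by linarith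
  have ha : 0 < a := by rw [hal]; positivity
  have ha2 : a ≤ 1 / 2 := by
    rw [hal]; exact one_div_le_one_div_of_le (by norm_num) (by linarith)
  have hK : Tendsto (fun n : ℕ => (3 * (2 + l) + 16) * (1 / ((n : ℝ) + 1))) atTop (𝓝 0) := by
    simpa using (tendsto_one_div_add_atTop_nhds_zero_nat (𝕜 := ℝ)).const_mul (3 * (2 + l) + 16)
  refine squeeze_zero_norm' ?_ hK
  filter_upwards [eventually_ge_atTop 5] with n hn
  have hn0 : (0 : ℝ) ≤ n := by positivity
  have y3 := adjSol_pos ha ha2 (show 5 ≤ n + 3 by omega)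
  have y4 := adjSol_pos ha ha2 (show 5 ≤ n + 4 by omega)
  have y5 := adjSol_pos ha ha2 (show 5 ≤ n + 5 by omega)
  have d4 := adjSol_succ_le ha ha2 (show 5 ≤ n + 3 by omega)
  have e4 : adjSol a (n + 4) ≤ adjSol a (n + 3) :=
    adjSol_succ_le_self ha ha2 (show 5 ≤ n + 3 by omega)
  have e5 : adjSol a (n + 5) ≤ adjSol a (n + 4) :=
    adjSol_succ_le_self ha ha2 (show 5 ≤ n + 4 by omega)
  obtain ⟨c1, c12⟩ := hc n
  obtain ⟨c2, c23⟩ := hc (n + 1)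
  obtain ⟨c3, -⟩ := hc (n + 2)
  have x1 := hxc n
  have x2 := hxc (n + 1)
  simp only [show n + 1 + 2 = n + 3 by omega, show n + 1 + 1 = n + 2 by omega,
    show n + 3 + 1 = n + 4 by omega] at c2 c23 c3 x2 d4
  push_cast at c23 d4
  set Y := adjSol a (n + 3)
  have hb : ((2 + l) * (n + 2) + 4) * adjSol a (n + 4) ≤ (3 * (2 + l) + 12) * Y := by
    have h : ((n : ℝ) + 4) * adjSol a (n + 4) ≤ 3 * Y := by
      rw [show (n : ℝ) + 3 + 1 = n + 4 by ring, div_mul_eq_mul_div,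
        le_div_iff₀ (by positivity)] at d4
      linarith
    nlinarith [mul_le_mul_of_nonneg_left h hl2.le, mul_pos hl2 y4]
  have hcoef : |-((2 + l) * (n + 2) + 4) * adjSol a (n + 4) + 2 * adjSol a (n + 5)| ≤
      (3 * (2 + l) + 14) * Y := by
    have : 0 ≤ ((2 + l) * (n + 2) + 4) * adjSol a (n + 4) := by positivity
    have h0 : 0 ≤ (3 * (2 + l) + 12) * Y := by positivity
    rw [abs_le]
    constructor <;> linarith
  have hcc : c (n + 2) ≤ c (n + 3) / (n + 1) := by
    rw [le_div_iff₀ (by positivity)]; nlinarith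
  have hcc1 : c (n + 1) ≤ c (n + 2) := by nlinarith
  have hdiff : adjPairing a l x n / (Y * c (n + 3)) - x (n + 3) / c (n + 3) =
      ((-((2 + l) * (n + 2) + 4) * adjSol a (n + 4) + 2 * adjSol a (n + 5)) * x (n + 2) +
        2 * adjSol a (n + 4) * x (n + 1)) / (Y * c (n + 3)) := by
    have := y3.ne'
    have := c3.ne'
    unfold adjPairing
    field_simp
    ring
  rw [hdiff, Real.norm_eq_abs, abs_div, abs_of_pos (mul_pos y3 c3),
    div_le_iff₀ (mul_pos y3 c3)]
  calc _ ≤ |-((2 + l) * (n + 2) + 4) * adjSol a (n + 4) + 2 * adjSol a (n + 5)| * |x (n + 2)| +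
        2 * adjSol a (n + 4) * |x (n + 1)| := by
        refine (abs_add_le _ _).trans ?_
        rw [abs_mul, abs_mul (2 * _), abs_of_pos (show 0 < 2 * adjSol a (n + 4) by positivity)]
    _ ≤ (3 * (2 + l) + 14) * Y * c (n + 2) + 2 * Y * c (n + 2) := by
        refine add_le_add (mul_le_mul hcoef x2 (abs_nonneg _) (by positivity)) ?_
        exact mul_le_mul (by linarith) (x1.trans hcc1) (abs_nonneg _) (by positivity)
    _ = (3 * (2 + l) + 16) * Y * c (n + 2) := by ring
    _ ≤ (3 * (2 + l) + 16) * Y * (c (n + 3) / (n + 1)) :=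
        mul_le_mul_of_nonneg_left hcc (by positivity)
    _ = _ := by ring

end Recurrence

/-- With `λ ≥ 0`, `α = 1/(2+λ)`, `γ̂ = −λ/(2+λ)`,
`𝒮_λ = ∑_j (−2α)^j (j+1+α) ∑_m (−1)^m (2α²)^m/(Γ(m+1+γ̂) Γ(m+1+j))`,
`N = (2α−1)e^{−2α}/Γ(γ̂+1) + ½(√2 α)^{1−γ̂} J_{1+γ̂}(2√2 α) + 𝒮_λ` and
`D = (2α−1)e^{−2α}/Γ(γ̂+1) + ½(√2 α)^{1−γ̂}(J_{1+γ̂}(2√2 α) + 2√2 J_{2+γ̂}(2√2 α)) + 𝒮_λ`,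
one has `D ≠ 0` and `d_n/c_n → N/D`. -/
theorem stmt_18 (l : ℝ) (hl : 0 ≤ l)
    (α γ S N D : ℝ)
    (hαdef : α = 1 / (2 + l)) (hγdef : γ = -(l / (2 + l)))
    (hS : S = ∑' j : ℕ, (-(2 * α)) ^ j * ((j : ℝ) + 1 + α) *
      ∑' m : ℕ, ((-1 : ℝ) ^ m * (2 * α ^ 2) ^ m /
        (Real.Gamma ((m : ℝ) + 1 + γ) * Real.Gamma ((m : ℝ) + 1 + (j : ℝ)))))
    (hN : N = ((2 * α - 1) * Real.exp (-(2 * α))) / Real.Gamma (γ + 1) +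
      (1 / 2) * (Real.sqrt 2 * α) ^ (1 - γ) * besselJ (1 + γ) (2 * Real.sqrt 2 * α) + S)
    (hD : D = ((2 * α - 1) * Real.exp (-(2 * α))) / Real.Gamma (γ + 1) +
      (1 / 2) * (Real.sqrt 2 * α) ^ (1 - γ) *
        (besselJ (1 + γ) (2 * Real.sqrt 2 * α) +
          2 * Real.sqrt 2 * besselJ (2 + γ) (2 * Real.sqrt 2 * α)) + S)
    (c d : ℕ → ℝ)
    (hc0 : c 0 = 1) (hc1 : c 1 = 5 + l) (hc2 : c 2 = 28 + 17 * l + 2 * l ^ 2)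
    (hc3 : c 3 = 226 + 226 * l + 68 * l ^ 2 + 6 * l ^ 3)
    (hd0 : d 0 = 0) (hd1 : d 1 = 1 + l) (hd2 : d 2 = 8 + 9 * l + 2 * l ^ 2)
    (hd3 : d 3 = 66 + 98 * l + 44 * l ^ 2 + 6 * l ^ 3)
    (hcrec : ∀ n : ℕ, 4 ≤ n →
      c n = ((2 + l) * (n : ℝ) + 3) * c (n - 1)
            - ((2 + l) * ((n : ℝ) - 2) + 4) * c (n - 2) + 2 * c (n - 3))
    (hdrec : ∀ n : ℕ, 4 ≤ n →
      d n = ((2 + l) * (n : ℝ) + 3) * d (n - 1)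
            - ((2 + l) * ((n : ℝ) - 2) + 4) * d (n - 2) + 2 * d (n - 3)) :
    D ≠ 0 ∧
    Filter.Tendsto (fun n : ℕ => d n / c n) Filter.atTop (nhds (N / D)) := by
  have hl2 : 0 < 2 + l := by linarith
  have ha : 0 < α := by rw [hαdef]; positivity
  have ha2 : α ≤ 1 / 2 := by
    rw [hαdef]; exact one_div_le_one_div_of_le (by norm_num) (by linarith)
  have hla : (2 + l) * α = 1 := by rw [hαdef]; field_simp
  have hγ : γ = 2 * α - 1 := by rw [hγdef, hαdef]; field_simp; ring
  subst hγ
  rw [tsum_eq_tsum_dblTerm, tsum_shifted_dblTerm ha ha2] at hS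
  have hc : ∀ n : ℕ, c (n + 4) = ((2 + l) * (n + 4) + 3) * c (n + 3) -
      ((2 + l) * (n + 2) + 4) * c (n + 2) + 2 * c (n + 1) := fun n => by
    have h := hcrec (n + 4) (by omega)
    simp only [show n + 4 - 1 = n + 3 by omega, show n + 4 - 2 = n + 2 by omega,
      show n + 4 - 3 = n + 1 by omega] at h
    push_cast at h
    linear_combination h
  have hd : ∀ n : ℕ, d (n + 4) = ((2 + l) * (n + 4) + 3) * d (n + 3) -
      ((2 + l) * (n + 2) + 4) * d (n + 2) + 2 * d (n + 1) := fun n => by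
    have h := hdrec (n + 4) (by omega)
    simp only [show n + 4 - 1 = n + 3 by omega, show n + 4 - 2 = n + 2 by omega,
      show n + 4 - 3 = n + 1 by omega] at h
    push_cast at h
    linear_combination h
  have y1 := adjSol_rec' hl hαdef 1
  have y2 := adjSol_rec' hl hαdef 2
  norm_num at y1 y2
  have hs2 : Real.sqrt 2 ^ 2 = 2 := Real.sq_sqrt (by norm_num)
  have hG : Real.Gamma (2 * α - 1 + 1) = (rgam α 0)⁻¹ := by simp [rgam]
  have hJ1 : (Real.sqrt 2 * α) ^ (1 - (2 * α - 1)) *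
      besselJ (1 + (2 * α - 1)) (2 * Real.sqrt 2 * α) =
      2 * α ^ 2 * (adjSol α 0 - 2 * adjSol α 1 + adjSol α 2) := by
    have h := rpow_mul_besselJ ha 0
    simp only [Nat.cast_zero, zero_add, hs2] at h
    rw [h, ← adjSol_second_diff ha ha2 0]
  have hJ2 : (Real.sqrt 2 * α) ^ (1 - (2 * α - 1)) *
      besselJ (2 + (2 * α - 1)) (2 * Real.sqrt 2 * α) =
      2 * Real.sqrt 2 * α ^ 2 * (adjSol α 1 - 2 * adjSol α 2 + adjSol α 3) := by
    have h := rpow_mul_besselJ ha 1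
    rw [Nat.cast_one, one_add_one_eq_two, pow_succ, hs2, ← adjSol_second_diff ha ha2 1] at h
    exact h
  have hN' : N = α ^ 2 * adjPairing α l d 0 := by
    have h : N = α ^ 2 * ((1 + l) * adjSol α 1 + adjSol α 2) := by
      rw [hN, hS, hG, div_inv_eq_mul]
      linear_combination 1 / 2 * hJ1 - α * adjSol α 1 * hla
    rw [h]
    unfold adjPairing
    simp only [zero_add, hd1, hd2, hd3]
    push_cast
    linear_combination α ^ 2 * ((1 + l) * y1 + (8 + 9 * l + 2 * l ^ 2) * y2)
  have hD' : D = α ^ 2 * adjPairing α l c 0 := by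
    have h : D = α ^ 2 * ((5 + l) * adjSol α 1 - 7 * adjSol α 2 + 4 * adjSol α 3) := by
      rw [hD, hS, hG, div_inv_eq_mul]
      linear_combination 1 / 2 * hJ1 + Real.sqrt 2 * hJ2 - α * adjSol α 1 * hla +
        2 * α ^ 2 * (adjSol α 1 - 2 * adjSol α 2 + adjSol α 3) * hs2
    rw [h]
    unfold adjPairing
    simp only [zero_add, hc1, hc2, hc3]
    push_cast
    linear_combination α ^ 2 * ((5 + l) * y1 + (28 + 17 * l + 2 * l ^ 2) * y2)
  have hl_sq : 0 ≤ l ^ 2 := sq_nonneg l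
  have hl_cube : 0 ≤ l ^ 3 := pow_nonneg hl 3
  have gc := growth hl hc (by rw [hc1]; linarith) (by rw [hc1, hc2]; linarith)
    (by rw [hc2, hc3]; linarith)
  have gd := growth hl hd (by rw [hd1]; linarith) (by rw [hd1, hd2]; linarith)
    (by rw [hd2, hd3]; linarith)
  have ge := growth (x := fun n => c n - d n) hl (fun n => by linear_combination hc n - hd n)
    (by simp only [hc1, hd1]; linarith) (by simp only [hc1, hd1, hc2, hd2]; linarith)
    (by simp only [hc2, hd2, hc3, hd3]; linarith)
  have gc' : ∀ n : ℕ, 0 < c (n + 1) ∧ (n + 2) * c (n + 1) ≤ c (n + 2) :=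
    fun n => ⟨(gc n).1, (gc n).2.1⟩
  have tc := tendsto_adjPairing_div hl hαdef gc' fun n => (abs_of_pos (gc n).1).le
  have td := tendsto_adjPairing_div hl hαdef (x := d) gc' fun n => by
    rw [abs_of_pos (gd n).1]
    linarith [(ge n).1]
  simp only [adjPairing_eq hl hαdef hc] at tc
  simp only [adjPairing_eq hl hαdef hd] at td
  have cpos : ∀ n, 0 < c (n + 3) := fun n => (gc (n + 2)).1
  have tc' : Tendsto (fun n => adjPairing α l c 0 / (adjSol α (n + 3) * c (n + 3)))
      atTop (𝓝 1) := by
    have h := tc.add_const 1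
    rw [zero_add] at h
    refine h.congr fun n => ?_
    rw [div_self (cpos n).ne', sub_add_cancel]
  have hQ : adjPairing α l c 0 ≠ 0 := fun h0 => by
    simp only [h0, zero_div] at tc'
    exact zero_ne_one (tendsto_nhds_unique tendsto_const_nhds tc')
  refine ⟨by rw [hD']; positivity, (tendsto_add_atTop_iff_nat 3).1 ?_⟩
  have hlim := (tc'.const_mul (adjPairing α l d 0 / adjPairing α l c 0)).sub td
  rw [mul_one, sub_zero] at hlim
  rw [hN', hD', mul_div_mul_left _ _ (by positivity)]
  refine hlim.congr fun n => ?_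
  field_simp
  ring
end
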